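/- Let X, Y be free and identically distributed with a free Gamma distribution (equivalently, X^{-1} and Y^{-1} are free Poisson distributed with rate λ > 1 and jump size 1). Then R_3(Y X^{-1}, X^{-1} Y, Y) = 4λ²/(λ−1)^5. -/

import Mathlib

open scoped Classical
open Finset

noncomputable section

namespace FreeProbLukacs

variable {A : Type*}

/-- Ordered (non-commutative) product of a tuple. -/
def tprod [Monoid A] {n : ℕ} (X : Fin n → A) : A := (List.ofFn X).prod

/-- `P` is a partition of `Fin n`: a finset of nonempty blocks, each point in a unique block. -/
def IsPartition {n : ℕ} (P : Finset (Finset (Fin n))) : Prop :=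
  (∀ B ∈ P, B.Nonempty) ∧ ∀ i : Fin n, ∃! B, B ∈ P ∧ i ∈ B

/-- `P` is non-crossing: there are no `a < b < c < d` with `a, c` in one block and
`b, d` in a different block. -/
def IsNonCrossing {n : ℕ} (P : Finset (Finset (Fin n))) : Prop :=
  ∀ B₁ ∈ P, ∀ B₂ ∈ P, ∀ a ∈ B₁, ∀ b ∈ B₂, ∀ c ∈ B₁, ∀ d ∈ B₂,
    a < b → b < c → c < d → B₁ = B₂

/-- The finset of all non-crossing partitions of `Fin n`. -/
def NC (n : ℕ) : Finset (Finset (Finset (Fin n))) :=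
  univ.filter fun P => IsPartition P ∧ IsNonCrossing P

/-- The cumulant functional `R` applied to the entries of `X` lying in a block `B`,
taken in increasing order of position. -/
def blockCum (R : ∀ n, (Fin n → A) → ℂ) {n : ℕ} (X : Fin n → A) (B : Finset (Fin n)) : ℂ :=
  R B.card fun j => X ((B.sort (· ≤ ·)).get (Fin.cast (Finset.length_sort (· ≤ ·)).symm j))

/-- Product of block cumulants over the blocks of a partition. -/
def partCum (R : ∀ n, (Fin n → A) → ℂ) {n : ℕ} (X : Fin n → A)
    (P : Finset (Finset (Fin n))) : ℂ :=
  ∏ B ∈ P, blockCum R X B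

/-- The moment–cumulant formula: `R` is the family of free cumulants of `φ`. -/
def MomentCumulant [Monoid A] (φ : A → ℂ) (R : ∀ n, (Fin n → A) → ℂ) : Prop :=
  ∀ (n : ℕ) (X : Fin n → A), φ (tprod X) = ∑ P ∈ NC n, partCum R X P

/-- Density of the absolutely continuous part of the Marchenko–Pastur law. -/
def freePoissonDensity (l a x : ℝ) : ℝ :=
  Real.sqrt (4 * l * a ^ 2 - (x - a * (1 + l)) ^ 2) / (2 * Real.pi * a * x)

/-- The free Poisson (Marchenko–Pastur) distribution with rate `l` and jump size `a`. -/
def freePoissonMeasure (l a : ℝ) : MeasureTheory.Measure ℝ :=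
  ENNReal.ofReal (max 0 (1 - l)) • MeasureTheory.Measure.dirac 0 +
    MeasureTheory.volume.withDensity fun x => ENNReal.ofReal (freePoissonDensity l a x)

/-- `X` has distribution `μ` in the sense of moments. -/
def HasMoments [Monoid A] (φ : A → ℂ) (X : A) (μ : MeasureTheory.Measure ℝ) : Prop :=
  ∀ r : ℕ, φ (X ^ r) = ((∫ t, t ^ r ∂μ : ℝ) : ℂ)

/-- `φ` is a state: unital and positive. -/
def IsState [Ring A] [StarRing A] [Module ℂ A] (φ : A →ₗ[ℂ] ℂ) : Prop :=
  φ 1 = 1 ∧ ∀ a : A, ∃ r : ℝ, 0 ≤ r ∧ φ (star a * a) = (r : ℂ)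

/-- `φ` is faithful. -/
def Faithful [Ring A] [StarRing A] [Module ℂ A] (φ : A →ₗ[ℂ] ℂ) : Prop :=
  ∀ a : A, φ (star a * a) = 0 → a = 0

/-- `φ` is tracial. -/
def Tracial [Ring A] [Module ℂ A] (φ : A →ₗ[ℂ] ℂ) : Prop :=
  ∀ a b : A, φ (a * b) = φ (b * a)

/-- All mixed cumulants with entries from `S` and from `T` vanish. -/
def MixedVanish (R : ∀ n, (Fin n → A) → ℂ) (S T : Set A) : Prop :=
  ∀ (n : ℕ) (f : Fin n → A), (∀ i, f i ∈ S ∪ T) → (∃ i, f i ∈ S) → (∃ j, f j ∈ T) →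
    R n f = 0

/-- Two elements are free: all their mixed free cumulants vanish. -/
def FreeElems (R : ∀ n, (Fin n → A) → ℂ) (x y : A) : Prop :=
  MixedVanish R {x} {y}

/-- Interleaving of a partition `P` (placed at positions `1,2,…,n`, i.e. evens)
and `Q` (placed at positions `1̄,…,n̄`, i.e. odds) inside `Fin (2 * n)`. -/
def interleave {n : ℕ} (P Q : Finset (Finset (Fin n))) : Finset (Finset (Fin (2 * n))) :=
  P.image (fun B => B.image fun i => (⟨2 * i.1, by have := i.isLt; omega⟩ : Fin (2 * n)))
    ∪ Q.image (fun B => B.image fun i => (⟨2 * i.1 + 1, by have := i.isLt; omega⟩ : Fin (2 * n)))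

/-- `Q` refines ... : every block of `P` is contained in a block of `Q`. -/
def Refines {n : ℕ} (P Q : Finset (Finset (Fin n))) : Prop :=
  ∀ B ∈ P, ∃ C ∈ Q, B ⊆ C

/-- `Q` is the Kreweras complement of `P`: the largest partition whose interleaving
with `P` is non-crossing. -/
def IsKrewerasComplement {n : ℕ} (P Q : Finset (Finset (Fin n))) : Prop :=
  IsPartition Q ∧ IsNonCrossing (interleave P Q) ∧
    ∀ Q', IsPartition Q' → IsNonCrossing (interleave P Q') → Refines Q' Q

end FreeProbLukacs

namespace FreeProbLukacs

lemma mem_NC {n : ℕ} {P : Finset (Finset (Fin n))} :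
    P ∈ NC n ↔ IsPartition P ∧ IsNonCrossing P := by
  simp [NC]

section

set_option synthInstance.maxSize 4096

lemma NC_one : NC 1 = {{{0}}} := by
  ext P
  rw [mem_NC, IsPartition, IsNonCrossing]
  simp only [ExistsUnique]
  revert P
  decide +kernel

lemma NC_two : NC 2 = {{{0, 1}}, {{0}, {1}}} := by
  ext P
  rw [mem_NC, IsPartition, IsNonCrossing]
  simp only [ExistsUnique]
  revert P
  decide +kernel

lemma NC_three :
    NC 3 = {{{0, 1, 2}}, {{0}, {1, 2}}, {{1}, {0, 2}}, {{2}, {0, 1}}, {{0}, {1}, {2}}} := by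
  ext P
  rw [mem_NC, IsPartition, IsNonCrossing]
  simp only [ExistsUnique]
  revert P
  decide +kernel

end

/-- A family of functionals on tuples, seen as a functional on lists. -/
def listCum {A : Type*} (R : ∀ n, (Fin n → A) → ℂ) (L : List A) : ℂ := R L.length L.get

lemma listCum_ofFn {A : Type*} (R : ∀ n, (Fin n → A) → ℂ) {n : ℕ} (f : Fin n → A) :
    listCum R (List.ofFn f) = R n f := by
  have key : ∀ (m : ℕ) (h : m = n) (g : Fin m → A), (∀ i, g i = f (Fin.cast h i)) →
      R m g = R n f := by
    rintro m rfl g hg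
    exact congrArg _ (funext hg)
  exact key _ List.length_ofFn _ fun i => by simp; rfl

lemma blockCum_eq_listCum {A : Type*} (R : ∀ n, (Fin n → A) → ℂ) {n : ℕ} (X : Fin n → A)
    (B : Finset (Fin n)) :
    blockCum R X B = listCum R ((B.sort (· ≤ ·)).map X) := by
  rw [blockCum, ← listCum_ofFn R]
  congr 1
  apply List.ext_get <;> simp

lemma cumulant_one {A : Type*} [Monoid A] {φ : A → ℂ} {R : ∀ n, (Fin n → A) → ℂ}
    (h : MomentCumulant φ R) (a : A) : φ a = listCum R [a] := by
  have := h 1 ![a]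
  simpa [tprod, NC_one, partCum, blockCum_eq_listCum] using this

lemma cumulant_two {A : Type*} [Monoid A] {φ : A → ℂ} {R : ∀ n, (Fin n → A) → ℂ}
    (h : MomentCumulant φ R) (a b : A) :
    φ (a * b) = listCum R [a, b] + φ a * φ b := by
  have := h 2 ![a, b]
  have s01 : ({0, 1} : Finset (Fin 2)).sort (· ≤ ·) = [0, 1] := by
    rw [sort_insert _ (by decide) (by decide), sort_singleton]
  rw [NC_two, sum_pair (by decide +kernel)] at this
  simp only [partCum] at this
  rw [prod_pair (by decide +kernel)] at this
  simpa [tprod, blockCum_eq_listCum, s01, ← cumulant_one h] using this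

lemma cumulant_three {A : Type*} [Monoid A] {φ : A → ℂ} {R : ∀ n, (Fin n → A) → ℂ}
    (h : MomentCumulant φ R) (a b c : A) :
    R 3 ![a, b, c] = φ (a * b * c) - φ a * φ (b * c) - φ b * φ (a * c) - φ c * φ (a * b)
      + 2 * φ a * φ b * φ c := by
  have := h 3 ![a, b, c]
  have s012 : ({0, 1, 2} : Finset (Fin 3)).sort (· ≤ ·) = [0, 1, 2] := by
    rw [sort_insert _ (by decide) (by decide), sort_insert _ (by decide) (by decide),
      sort_singleton]
  have s01 : ({0, 1} : Finset (Fin 3)).sort (· ≤ ·) = [0, 1] := by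
    rw [sort_insert _ (by decide) (by decide), sort_singleton]
  have s02 : ({0, 2} : Finset (Fin 3)).sort (· ≤ ·) = [0, 2] := by
    rw [sort_insert _ (by decide) (by decide), sort_singleton]
  have s12 : ({1, 2} : Finset (Fin 3)).sort (· ≤ ·) = [1, 2] := by
    rw [sort_insert _ (by decide) (by decide), sort_singleton]
  rw [NC_three, sum_insert (by decide +kernel), sum_insert (by decide +kernel),
    sum_insert (by decide +kernel), sum_pair (by decide +kernel)] at this
  simp only [partCum] at this
  rw [prod_pair (by decide +kernel), prod_pair (by decide +kernel),
    prod_pair (by decide +kernel), prod_insert (by decide +kernel),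
    prod_pair (by decide +kernel)] at this
  simp [tprod, blockCum_eq_listCum, s012, s01, s02, s12, ← cumulant_one h] at this
  have e : listCum R [a, b, c] = R 3 ![a, b, c] := by
    rw [← listCum_ofFn R]; simp
  rw [← e, cumulant_two h a b, cumulant_two h a c, cumulant_two h b c, mul_assoc, this]
  ring

/-- Transport of a family of blocks along an order embedding. -/
def mapBlocks {k N : ℕ} (e : Fin k ↪o Fin N) (P : Finset (Finset (Fin k))) :
    Finset (Finset (Fin N)) :=
  P.map (mapEmbedding e.toEmbedding).toEmbedding

/-- The blocks of `Q` lying in the range of an order embedding, pulled back along it. -/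
def comapBlocks {k N : ℕ} (e : Fin k ↪o Fin N) (Q : Finset (Finset (Fin N))) :
    Finset (Finset (Fin k)) :=
  univ.filter fun B => B.map e.toEmbedding ∈ Q

lemma mem_mapBlocks {k N : ℕ} {e : Fin k ↪o Fin N} {P : Finset (Finset (Fin k))}
    {B : Finset (Fin N)} : B ∈ mapBlocks e P ↔ ∃ C ∈ P, C.map e.toEmbedding = B := by
  simp [mapBlocks]

lemma mem_comapBlocks {k N : ℕ} {e : Fin k ↪o Fin N} {Q : Finset (Finset (Fin N))}
    {B : Finset (Fin k)} : B ∈ comapBlocks e Q ↔ B.map e.toEmbedding ∈ Q := by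
  simp [comapBlocks]

lemma exists_map_eq {k N : ℕ} (e : Fin k ↪o Fin N) {B : Finset (Fin N)}
    (h : ∀ b ∈ B, b ∈ Set.range e) : ∃ C : Finset (Fin k), C.map e.toEmbedding = B := by
  refine ⟨univ.filter fun i => e i ∈ B, ?_⟩
  ext b
  simp only [mem_map, mem_filter, mem_univ, true_and, RelEmbedding.coe_toEmbedding]
  constructor
  · rintro ⟨a, ha, rfl⟩
    exact ha
  · intro hb
    obtain ⟨a, rfl⟩ := h b hb
    exact ⟨a, hb, rfl⟩

lemma comapBlocks_mem_NC {k N : ℕ} (e : Fin k ↪o Fin N) {Q : Finset (Finset (Fin N))}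
    (hQ : Q ∈ NC N)
    (h : ∀ B ∈ Q, (∃ i, e i ∈ B) → ∀ b ∈ B, b ∈ Set.range e) :
    comapBlocks e Q ∈ NC k := by
  obtain ⟨⟨hne, hun⟩, hnc⟩ := mem_NC.1 hQ
  refine mem_NC.2 ⟨⟨fun B hB => ?_, fun i => ?_⟩, ?_⟩
  · simpa using hne _ (mem_comapBlocks.1 hB)
  · obtain ⟨B, ⟨hB, hiB⟩, hu⟩ := hun (e i)
    obtain ⟨C, rfl⟩ := exists_map_eq e (h B hB ⟨i, hiB⟩)
    refine ⟨C, ⟨mem_comapBlocks.2 hB, by simpa using hiB⟩, ?_⟩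
    rintro D ⟨hD, hiD⟩
    exact map_injective _ (hu _ ⟨mem_comapBlocks.1 hD, by simpa using hiD⟩)
  · intro B₁ h₁ B₂ h₂ a ha b hb c hc d hd hab hbc hcd
    refine map_injective e.toEmbedding (hnc _ (mem_comapBlocks.1 h₁) _ (mem_comapBlocks.1 h₂)
      (e a) ?_ (e b) ?_ (e c) ?_ (e d) ?_ ?_ ?_ ?_) <;> simpa

lemma partCum_mapBlocks {A : Type*} (R : ∀ n, (Fin n → A) → ℂ) {k N : ℕ} (e : Fin k ↪o Fin N)
    (Z : Fin N → A) (P : Finset (Finset (Fin k))) :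
    partCum R Z (mapBlocks e P) = partCum R (Z ∘ e) P := by
  rw [partCum, partCum, mapBlocks, prod_map]
  refine prod_congr rfl fun B _ => ?_
  rw [blockCum_eq_listCum, blockCum_eq_listCum, ← List.map_map]
  congr 2
  exact (map_sort e.toEmbedding B _ _ fun a _ b _ => e.le_iff_le.symm).symm

/-- Juxtaposition of a partition of `Fin m` and a partition of `Fin n`. -/
def juxtapose {m n : ℕ} (P : Finset (Finset (Fin m))) (Q : Finset (Finset (Fin n))) :
    Finset (Finset (Fin (m + n))) :=
  mapBlocks (Fin.castAddOrderEmb n) P ∪ mapBlocks (Fin.natAddOrderEmb m) Q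

lemma mem_juxtapose {m n : ℕ} {P : Finset (Finset (Fin m))} {Q : Finset (Finset (Fin n))}
    {B : Finset (Fin (m + n))} :
    B ∈ juxtapose P Q ↔ (∃ C ∈ P, C.map (Fin.castAddOrderEmb n).toEmbedding = B) ∨
      ∃ C ∈ Q, C.map (Fin.natAddOrderEmb m).toEmbedding = B := by
  rw [juxtapose, mem_union, mem_mapBlocks, mem_mapBlocks]

lemma castAdd_ne_natAdd {m n : ℕ} (i : Fin m) (j : Fin n) : Fin.castAdd n i ≠ Fin.natAdd m j := by
  intro h
  have := congrArg Fin.val h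
  simp at this
  omega

lemma juxtapose_mem_NC {m n : ℕ} {P : Finset (Finset (Fin m))} {Q : Finset (Finset (Fin n))}
    (hP : P ∈ NC m) (hQ : Q ∈ NC n) : juxtapose P Q ∈ NC (m + n) := by
  obtain ⟨⟨hPne, hPun⟩, hPnc⟩ := mem_NC.1 hP
  obtain ⟨⟨hQne, hQun⟩, hQnc⟩ := mem_NC.1 hQ
  refine mem_NC.2 ⟨⟨fun B hB => ?_, fun i => ?_⟩, ?_⟩
  · rcases mem_juxtapose.1 hB with ⟨C, hC, rfl⟩ | ⟨C, hC, rfl⟩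
    · simpa using hPne C hC
    · simpa using hQne C hC
  · induction i using Fin.addCases with
    | left i =>
      obtain ⟨C, ⟨hC, hi⟩, hu⟩ := hPun i
      refine ⟨_, ⟨mem_juxtapose.2 (Or.inl ⟨C, hC, rfl⟩), (mem_map' _).2 hi⟩, ?_⟩
      rintro B ⟨hB, hiB⟩
      rcases mem_juxtapose.1 hB with ⟨D, hD, rfl⟩ | ⟨D, hD, rfl⟩
      · rw [hu D ⟨hD, (mem_map' _).1 hiB⟩]
      · obtain ⟨j, -, hj⟩ := mem_map.1 hiB
        exact absurd hj.symm (castAdd_ne_natAdd i j)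
    | right i =>
      obtain ⟨C, ⟨hC, hi⟩, hu⟩ := hQun i
      refine ⟨_, ⟨mem_juxtapose.2 (Or.inr ⟨C, hC, rfl⟩), (mem_map' _).2 hi⟩, ?_⟩
      rintro B ⟨hB, hiB⟩
      rcases mem_juxtapose.1 hB with ⟨D, hD, rfl⟩ | ⟨D, hD, rfl⟩
      · obtain ⟨j, -, hj⟩ := mem_map.1 hiB
        exact absurd hj (castAdd_ne_natAdd j i)
      · rw [hu D ⟨hD, (mem_map' _).1 hiB⟩]
  · intro B₁ h₁ B₂ h₂ a ha b hb c hc d hd hab hbc hcd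
    rcases mem_juxtapose.1 h₁ with ⟨C₁, hC₁, rfl⟩ | ⟨C₁, hC₁, rfl⟩ <;>
    rcases mem_juxtapose.1 h₂ with ⟨C₂, hC₂, rfl⟩ | ⟨C₂, hC₂, rfl⟩ <;>
    obtain ⟨a, ha', rfl⟩ := mem_map.1 ha <;> obtain ⟨b, hb', rfl⟩ := mem_map.1 hb <;>
    obtain ⟨c, hc', rfl⟩ := mem_map.1 hc <;> obtain ⟨d, hd', rfl⟩ := mem_map.1 hd
    · rw [hPnc C₁ hC₁ C₂ hC₂ a ha' b hb' c hc' d hd'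
        ((OrderEmbedding.lt_iff_lt _).1 hab) ((OrderEmbedding.lt_iff_lt _).1 hbc)
        ((OrderEmbedding.lt_iff_lt _).1 hcd)]
    · simp only [Fin.lt_def, RelEmbedding.coe_toEmbedding, Fin.castAddOrderEmb_apply,
        Fin.natAddOrderEmb_apply, Fin.val_castAdd, Fin.val_natAdd] at hab hbc hcd
      omega
    · simp only [Fin.lt_def, RelEmbedding.coe_toEmbedding, Fin.castAddOrderEmb_apply,
        Fin.natAddOrderEmb_apply, Fin.val_castAdd, Fin.val_natAdd] at hab hbc hcd
      omega
    · rw [hQnc C₁ hC₁ C₂ hC₂ a ha' b hb' c hc' d hd'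
        ((OrderEmbedding.lt_iff_lt _).1 hab) ((OrderEmbedding.lt_iff_lt _).1 hbc)
        ((OrderEmbedding.lt_iff_lt _).1 hcd)]

lemma comapBlocks_castAdd_juxtapose {m n : ℕ} {P : Finset (Finset (Fin m))}
    {Q : Finset (Finset (Fin n))} (hQ : Q ∈ NC n) :
    comapBlocks (Fin.castAddOrderEmb n) (juxtapose P Q) = P := by
  ext B
  rw [mem_comapBlocks, mem_juxtapose]
  constructor
  · rintro (⟨C, hC, h⟩ | ⟨C, hC, h⟩)
    · rwa [← map_injective _ h]
    · obtain ⟨j, hj⟩ := (mem_NC.1 hQ).1.1 C hC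
      have : Fin.natAdd m j ∈ C.map (Fin.natAddOrderEmb m).toEmbedding :=
        (mem_map' _).2 hj
      rw [h] at this
      obtain ⟨i, -, hi⟩ := mem_map.1 this
      exact absurd hi (castAdd_ne_natAdd i j)
  · exact fun hB => Or.inl ⟨B, hB, rfl⟩

lemma comapBlocks_natAdd_juxtapose {m n : ℕ} {P : Finset (Finset (Fin m))}
    {Q : Finset (Finset (Fin n))} (hP : P ∈ NC m) :
    comapBlocks (Fin.natAddOrderEmb m) (juxtapose P Q) = Q := by
  ext B
  rw [mem_comapBlocks, mem_juxtapose]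
  constructor
  · rintro (⟨C, hC, h⟩ | ⟨C, hC, h⟩)
    · obtain ⟨j, hj⟩ := (mem_NC.1 hP).1.1 C hC
      have : Fin.castAdd n j ∈ C.map (Fin.castAddOrderEmb n).toEmbedding :=
        (mem_map' _).2 hj
      rw [h] at this
      obtain ⟨i, -, hi⟩ := mem_map.1 this
      exact absurd hi.symm (castAdd_ne_natAdd j i)
    · rwa [← map_injective _ h]
  · exact fun hB => Or.inr ⟨B, hB, rfl⟩

lemma juxtapose_comapBlocks {m n : ℕ} {Q : Finset (Finset (Fin (m + n)))}
    (h : ∀ B ∈ Q, (∀ b ∈ B, b ∈ Set.range (Fin.castAddOrderEmb n : Fin m ↪o Fin (m + n))) ∨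
      ∀ b ∈ B, b ∈ Set.range (Fin.natAddOrderEmb m : Fin n ↪o Fin (m + n))) :
    juxtapose (comapBlocks (Fin.castAddOrderEmb n) Q) (comapBlocks (Fin.natAddOrderEmb m) Q)
      = Q := by
  ext B
  rw [mem_juxtapose]
  constructor
  · rintro (⟨C, hC, rfl⟩ | ⟨C, hC, rfl⟩) <;> exact mem_comapBlocks.1 hC
  · intro hB
    rcases h B hB with h | h
    · obtain ⟨C, rfl⟩ := exists_map_eq _ h
      exact Or.inl ⟨C, mem_comapBlocks.2 hB, rfl⟩
    · obtain ⟨C, rfl⟩ := exists_map_eq _ h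
      exact Or.inr ⟨C, mem_comapBlocks.2 hB, rfl⟩

lemma blockCum_eq_zero {A : Type*} {R : ∀ n, (Fin n → A) → ℂ} {S T : Set A}
    (hR : MixedVanish R S T) {n : ℕ} {Z : Fin n → A} (hZ : ∀ i, Z i ∈ S ∪ T)
    {B : Finset (Fin n)} {i j : Fin n} (hi : i ∈ B) (hj : j ∈ B) (hiS : Z i ∈ S)
    (hjT : Z j ∈ T) : blockCum R Z B = 0 := by
  have key : ∀ i ∈ B, ∃ k : Fin B.card, (B.sort (· ≤ ·)).get
      (Fin.cast (Finset.length_sort (· ≤ ·)).symm k) = i := by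
    intro i hi
    obtain ⟨k, hk⟩ := List.mem_iff_get.1 ((mem_sort (· ≤ ·)).2 hi)
    exact ⟨Fin.cast (Finset.length_sort (· ≤ ·)) k, by simpa using hk⟩
  obtain ⟨k, hk⟩ := key i hi
  obtain ⟨k', hk'⟩ := key j hj
  refine hR _ _ (fun _ => hZ _) ⟨k, ?_⟩ ⟨k', ?_⟩
  · rwa [hk]
  · rwa [hk']

/-- Moments of a word split into two free halves factor. -/
theorem map_tprod_mul_tprod {A : Type*} [Monoid A] {φ : A → ℂ} {R : ∀ n, (Fin n → A) → ℂ}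
    (hmc : MomentCumulant φ R) {S T : Set A} (hR : MixedVanish R S T) {m n : ℕ}
    {x : Fin m → A} {y : Fin n → A} (hx : ∀ i, x i ∈ S) (hy : ∀ i, y i ∈ T) :
    φ (tprod x * tprod y) = φ (tprod x) * φ (tprod y) := by
  have hxy : tprod x * tprod y = tprod (Fin.append x y) := by
    simp [tprod, List.ofFn_fin_append]
  have hZ : ∀ i, Fin.append x y i ∈ S ∪ T := by
    intro i
    induction i using Fin.addCases with
    | left i => simpa using Or.inl (hx i)
    | right i => simpa using Or.inr (hy i)
  rw [hxy, hmc, hmc, hmc, sum_mul_sum, ← sum_product']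
  symm
  refine sum_of_injOn (fun p => juxtapose p.1 p.2) ?_ ?_ ?_ ?_
  · rintro ⟨P, Q⟩ h ⟨P', Q'⟩ h' heq
    simp only [coe_product, Set.mem_prod, mem_coe] at h h' heq
    ext1
    · rw [← comapBlocks_castAdd_juxtapose (P := P) h.2, heq, comapBlocks_castAdd_juxtapose h'.2]
    · rw [← comapBlocks_natAdd_juxtapose (Q := Q) h.1, heq, comapBlocks_natAdd_juxtapose h'.1]
  · rintro ⟨P, Q⟩ h
    simp only [coe_product, Set.mem_prod, mem_coe] at h
    exact juxtapose_mem_NC h.1 h.2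
  · intro Q hQ hQ'
    by_contra hne
    have hsep : ∀ B ∈ Q, ∀ i j, Fin.castAdd n i ∈ B → Fin.natAdd m j ∉ B := by
      intro B hB i j hi hj
      exact hne (prod_eq_zero hB (blockCum_eq_zero hR hZ hi hj (by simpa using hx i)
        (by simpa using hy j)))
    have hl : ∀ B ∈ Q, (∃ i, Fin.castAddOrderEmb n i ∈ B) →
        ∀ b ∈ B, b ∈ Set.range (Fin.castAddOrderEmb n : Fin m ↪o Fin (m + n)) := by
      rintro B hB ⟨i, hi⟩ b hb
      induction b using Fin.addCases with
      | left b => exact ⟨b, rfl⟩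
      | right b => exact absurd hb (hsep B hB i b hi)
    have hr : ∀ B ∈ Q, (∃ i, Fin.natAddOrderEmb m i ∈ B) →
        ∀ b ∈ B, b ∈ Set.range (Fin.natAddOrderEmb m : Fin n ↪o Fin (m + n)) := by
      rintro B hB ⟨i, hi⟩ b hb
      induction b using Fin.addCases with
      | left b => exact absurd hi (hsep B hB b i hb)
      | right b => exact ⟨b, rfl⟩
    refine hQ' ⟨(comapBlocks (Fin.castAddOrderEmb n) Q, comapBlocks (Fin.natAddOrderEmb m) Q),
      ?_, juxtapose_comapBlocks fun B hB => ?_⟩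
    · simp only [coe_product, Set.mem_prod, mem_coe]
      exact ⟨comapBlocks_mem_NC _ hQ hl, comapBlocks_mem_NC _ hQ hr⟩
    · obtain ⟨b, hb⟩ := (mem_NC.1 hQ).1.1 B hB
      induction b using Fin.addCases with
      | left b => exact Or.inl (hl B hB ⟨b, hb⟩)
      | right b => exact Or.inr (hr B hB ⟨b, hb⟩)
  · rintro ⟨P, Q⟩ h
    simp only [mem_product] at h
    have hd : Disjoint (mapBlocks (Fin.castAddOrderEmb n) P)
        (mapBlocks (Fin.natAddOrderEmb m) Q) := by
      rw [Finset.disjoint_left]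
      intro B hB hB'
      obtain ⟨C, hC, rfl⟩ := mem_mapBlocks.1 hB
      obtain ⟨D, hD, hCD⟩ := mem_mapBlocks.1 hB'
      obtain ⟨i, hi⟩ := (mem_NC.1 h.1).1.1 C hC
      have : Fin.castAdd n i ∈ C.map (Fin.castAddOrderEmb n).toEmbedding :=
        (mem_map' _).2 hi
      rw [← hCD] at this
      obtain ⟨j, -, hj⟩ := mem_map.1 this
      exact castAdd_ne_natAdd i j hj.symm
    change _ = ∏ B ∈ mapBlocks _ P ∪ mapBlocks _ Q, _
    rw [prod_union hd]
    change _ = partCum R _ (mapBlocks _ P) * partCum R _ (mapBlocks _ Q)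
    rw [partCum_mapBlocks, partCum_mapBlocks]
    congr 2 <;> ext i <;> simp

/-- The quadratic polynomial under the square root of the Marchenko–Pastur density of jump
size `1`. -/
def mpQuad (l t : ℝ) : ℝ := 4 * l - (t - (1 + l)) ^ 2

lemma mpQuad_eq {l : ℝ} (hl : 0 ≤ l) (t : ℝ) :
    mpQuad l t = (t - (√l - 1) ^ 2) * ((√l + 1) ^ 2 - t) := by
  have h := Real.sq_sqrt hl
  rw [mpQuad]
  linear_combination (√l ^ 2 + l - 2 * t - 2) * h

lemma mp_left_pos {l : ℝ} (hl : 1 < l) : 0 < (√l - 1) ^ 2 := by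
  have : 1 < √l := Real.lt_sqrt_of_sq_lt (by simpa using hl)
  have : 0 < √l - 1 := by linarith
  positivity

lemma mp_left_le_right (l : ℝ) : (√l - 1) ^ 2 ≤ (√l + 1) ^ 2 := by
  nlinarith [Real.sqrt_nonneg l]

lemma mpQuad_left {l : ℝ} (hl : 0 ≤ l) : mpQuad l ((√l - 1) ^ 2) = 0 := by
  simp [mpQuad_eq hl]

lemma mpQuad_right {l : ℝ} (hl : 0 ≤ l) : mpQuad l ((√l + 1) ^ 2) = 0 := by
  simp [mpQuad_eq hl]

lemma continuous_mpQuad (l : ℝ) : Continuous (mpQuad l) := by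
  unfold mpQuad
  fun_prop

lemma hasDerivAt_mpQuad (l t : ℝ) : HasDerivAt (mpQuad l) (-(2 * (t - (1 + l)))) t := by
  have := (((hasDerivAt_id t).sub_const (1 + l)).pow 2).const_sub (4 * l)
  exact this.congr_deriv (by simp)

/-- Integral of `t ^ k` against the numerator of the Marchenko–Pastur density. -/
def mpInt (l : ℝ) (k : ℤ) : ℝ :=
  ∫ t in (√l - 1) ^ 2..(√l + 1) ^ 2, t ^ k * √(mpQuad l t)

lemma continuousOn_zpow_mul_sqrt_mpQuad {l : ℝ} (hl : 1 < l) (k : ℤ) :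
    ContinuousOn (fun t => t ^ k * √(mpQuad l t))
      (Set.uIcc ((√l - 1) ^ 2) ((√l + 1) ^ 2)) := by
  rw [Set.uIcc_of_le (mp_left_le_right l)]
  refine ContinuousOn.mul (fun t ht => ?_) (continuous_mpQuad l).sqrt.continuousOn
  exact (continuousAt_zpow₀ t k
    (Or.inl ((mp_left_pos hl).trans_le ht.1).ne')).continuousWithinAt

/-- The integration by parts recurrence, from the derivative of `t ^ m * q(t) ^ (3/2)`. -/
lemma mpInt_recurrence {l : ℝ} (hl : 1 < l) (m : ℤ) :
    (m + 3) * mpInt l (m + 1) =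
      (2 * m + 3) * (1 + l) * mpInt l m - m * (l - 1) ^ 2 * mpInt l (m - 1) := by
  have hl0 : 0 ≤ l := by linarith
  have hint : ∀ k : ℤ, IntervalIntegrable (fun t => t ^ k * √(mpQuad l t)) MeasureTheory.volume
      ((√l - 1) ^ 2) ((√l + 1) ^ 2) :=
    fun k => (continuousOn_zpow_mul_sqrt_mpQuad hl k).intervalIntegrable
  have hcont : ContinuousOn (fun t => t ^ m * √(mpQuad l t) * mpQuad l t)
      (Set.Icc ((√l - 1) ^ 2) ((√l + 1) ^ 2)) := by
    have := continuousOn_zpow_mul_sqrt_mpQuad hl m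
    rw [Set.uIcc_of_le (mp_left_le_right l)] at this
    exact this.mul (continuous_mpQuad l).continuousOn
  have hint' := (((hint (m + 1)).const_mul (-(m + 3 : ℝ))).add
    ((hint m).const_mul ((2 * m + 3) * (1 + l)))).sub
      ((hint (m - 1)).const_mul (m * (l - 1) ^ 2))
  have hderiv : ∀ t ∈ Set.Ioo ((√l - 1) ^ 2) ((√l + 1) ^ 2),
      HasDerivAt (fun t => t ^ m * √(mpQuad l t) * mpQuad l t)
        (-(m + 3 : ℝ) * (t ^ (m + 1) * √(mpQuad l t))
          + (2 * m + 3) * (1 + l) * (t ^ m * √(mpQuad l t))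
          - m * (l - 1) ^ 2 * (t ^ (m - 1) * √(mpQuad l t))) t := by
    intro t ht
    have ht0 : t ≠ 0 := ((mp_left_pos hl).trans ht.1).ne'
    have hq : 0 < mpQuad l t := by
      rw [mpQuad_eq hl0]
      exact mul_pos (by linarith [ht.1]) (by linarith [ht.2])
    have h := ((hasDerivAt_zpow m t (Or.inl ht0)).mul
      ((hasDerivAt_mpQuad l t).sqrt hq.ne')).mul (hasDerivAt_mpQuad l t)
    refine h.congr_deriv ?_
    simp only [Pi.mul_apply]
    have hs : √(mpQuad l t) ≠ 0 := (Real.sqrt_pos.2 hq).ne'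
    have hs2 := Real.sq_sqrt hq.le
    have e1 : t ^ (m + 1) = t ^ (m - 1) * t ^ 2 := by
      rw [← zpow_natCast, ← zpow_add₀ ht0]; congr 1; push_cast; ring
    have e2 : t ^ m = t ^ (m - 1) * t := by
      rw [← zpow_add_one₀ ht0]; congr 1; ring
    rw [e1, e2]
    have e3 : -(2 * (t - (1 + l))) / (2 * √(mpQuad l t)) * mpQuad l t =
        -(t - (1 + l)) * √(mpQuad l t) := by
      field_simp
      linear_combination (t - (1 + l)) * hs2
    have e4 : mpQuad l t = 4 * l - (t - (1 + l)) ^ 2 := rfl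
    linear_combination (t ^ (m - 1) * t) * e3
      + (m * t ^ (m - 1) * √(mpQuad l t)) * e4
  have key := intervalIntegral.integral_eq_sub_of_hasDerivAt_of_le (mp_left_le_right l) hcont
    hderiv hint'
  rw [intervalIntegral.integral_sub (((hint (m + 1)).const_mul (-(m + 3 : ℝ))).add
    ((hint m).const_mul ((2 * m + 3) * (1 + l)))) ((hint (m - 1)).const_mul (m * (l - 1) ^ 2)),
    intervalIntegral.integral_add ((hint (m + 1)).const_mul (-(m + 3 : ℝ)))
      ((hint m).const_mul ((2 * m + 3) * (1 + l))),
    intervalIntegral.integral_const_mul, intervalIntegral.integral_const_mul,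
    intervalIntegral.integral_const_mul, mpQuad_left hl0, mpQuad_right hl0] at key
  unfold mpInt
  linear_combination -key

/-- The symmetry relation, from the substitution `w = t + (l - 1) ^ 2 / t`, which takes the same
value at both endpoints. -/
lemma mpInt_neg_one {l : ℝ} (hl : 1 < l) : mpInt l (-1) = (l - 1) * mpInt l (-2) := by
  have hl0 : 0 ≤ l := by linarith
  have hd : 0 < l - 1 := by linarith
  have hpos : ∀ t ∈ Set.uIcc ((√l - 1) ^ 2) ((√l + 1) ^ 2), 0 < t := by
    rw [Set.uIcc_of_le (mp_left_le_right l)]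
    exact fun t ht => (mp_left_pos hl).trans_le ht.1
  have hint : ∀ k : ℤ, IntervalIntegrable (fun t => t ^ k * √(mpQuad l t)) MeasureTheory.volume
      ((√l - 1) ^ 2) ((√l + 1) ^ 2) :=
    fun k => (continuousOn_zpow_mul_sqrt_mpQuad hl k).intervalIntegrable
  have hw : ∀ t, 0 < t → 2 * (1 + l) - (t + (l - 1) ^ 2 / t) = mpQuad l t / t := by
    intro t ht
    rw [mpQuad]
    field_simp
    ring
  have hend : ∀ t, 0 < t → mpQuad l t = 0 → t + (l - 1) ^ 2 / t = 2 * (1 + l) := by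
    intro t ht h
    have := hw t ht
    rw [h, zero_div] at this
    linarith
  have key := intervalIntegral.integral_comp_mul_deriv' (a := (√l - 1) ^ 2) (b := (√l + 1) ^ 2)
    (f := fun t => t + (l - 1) ^ 2 / t) (f' := fun t => 1 - (l - 1) ^ 2 / t ^ 2)
    (g := fun w => √((2 * (1 + l) - w) / (w + 2 * (l - 1)))) ?_ ?_ ?_
  · simp only [hend _ (hpos _ Set.left_mem_uIcc) (mpQuad_left hl0),
      hend _ (hpos _ Set.right_mem_uIcc) (mpQuad_right hl0),
      intervalIntegral.integral_same] at key
    have e : ∫ t in (√l - 1) ^ 2..(√l + 1) ^ 2,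
        (t ^ (-1 : ℤ) * √(mpQuad l t) - (l - 1) * (t ^ (-2 : ℤ) * √(mpQuad l t))) = 0 := by
      rw [← key]
      refine intervalIntegral.integral_congr fun t ht => ?_
      have ht := hpos t ht
      have e1 : (2 * (1 + l) - (t + (l - 1) ^ 2 / t)) / (t + (l - 1) ^ 2 / t + 2 * (l - 1)) =
          mpQuad l t / (t + (l - 1)) ^ 2 := by
        have : t + (l - 1) ^ 2 / t + 2 * (l - 1) = (t + (l - 1)) ^ 2 / t := by
          field_simp
          ring
        rw [hw t ht, this, div_div_div_cancel_right₀ ht.ne']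
      have hp : 0 < t + (l - 1) := by positivity
      simp only [Function.comp, e1]
      rw [Real.sqrt_div' _ (sq_nonneg _), Real.sqrt_sq hp.le]
      simp only [zpow_neg, zpow_one]
      norm_cast
      field_simp
      ring
    rw [intervalIntegral.integral_sub (hint _) ((hint _).const_mul _),
      intervalIntegral.integral_const_mul] at e
    exact sub_eq_zero.1 e
  · intro t ht
    have ht := (hpos t ht).ne'
    have := (hasDerivAt_id t).add ((hasDerivAt_inv ht).const_mul ((l - 1) ^ 2))
    exact this.congr_deriv (by field_simp; ring)
  · refine continuousOn_const.sub (continuousOn_const.div (by fun_prop) fun t ht => ?_)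
    exact pow_ne_zero 2 (hpos t ht).ne'
  · refine ContinuousOn.sqrt (ContinuousOn.div (by fun_prop) (by fun_prop) ?_)
    rintro _ ⟨t, ht, rfl⟩
    have := hpos t ht
    positivity

lemma mpInt_zero {l : ℝ} (hl : 1 < l) : mpInt l 0 = l * mpInt l (-1) := by
  have h := mpInt_recurrence hl (-1)
  norm_num at h
  linear_combination h / 2 - (l - 1) / 2 * mpInt_neg_one hl

lemma mpInt_one {l : ℝ} (hl : 1 < l) : mpInt l 1 = l * (l + 1) * mpInt l (-1) := by
  have h := mpInt_recurrence hl 0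
  norm_num at h
  linear_combination h / 3 + (1 + l) * mpInt_zero hl

lemma mpInt_neg_three {l : ℝ} (hl : 1 < l) :
    mpInt l (-3) = l / (l - 1) ^ 3 * mpInt l (-1) := by
  have hd : l - 1 ≠ 0 := by linarith
  have h := mpInt_recurrence hl (-2)
  norm_num at h
  field_simp
  linear_combination -(l - 1) / 2 * h - (1 + l) / 2 * mpInt_neg_one hl

lemma mpInt_neg_four {l : ℝ} (hl : 1 < l) :
    mpInt l (-4) = l * (l + 1) / (l - 1) ^ 5 * mpInt l (-1) := by
  have hd : l - 1 ≠ 0 := by linarith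
  have h := mpInt_recurrence hl (-3)
  have h3 := mpInt_neg_three hl
  norm_num at h
  field_simp at h3 ⊢
  linear_combination -(l - 1) ^ 3 / 3 * h + (1 + l) * h3

lemma integral_freePoissonMeasure {l : ℝ} (hl : 1 < l) (f : ℝ → ℝ) :
    ∫ t, f t ∂(freePoissonMeasure l 1) =
      ∫ t in (√l - 1) ^ 2..(√l + 1) ^ 2, f t * freePoissonDensity l 1 t := by
  have hl0 : 0 ≤ l := by linarith
  have hdens : ∀ t, freePoissonDensity l 1 t = √(mpQuad l t) / (2 * Real.pi * t) := by
    intro t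
    simp [freePoissonDensity, mpQuad]
  have hmeas : Measurable (freePoissonDensity l 1) := by
    unfold freePoissonDensity
    fun_prop
  have hmax : max 0 (1 - l) = 0 := max_eq_left (by linarith)
  rw [freePoissonMeasure, hmax, ENNReal.ofReal_zero, zero_smul, zero_add,
    integral_withDensity_eq_integral_toReal_smul hmeas.ennreal_ofReal (by simp),
    intervalIntegral.integral_of_le (mp_left_le_right l),
    ← MeasureTheory.integral_Icc_eq_integral_Ioc,
    ← MeasureTheory.integral_indicator measurableSet_Icc]
  congr 1
  ext t
  by_cases ht : t ∈ Set.Icc ((√l - 1) ^ 2) ((√l + 1) ^ 2)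
  · rw [Set.indicator_of_mem ht, ENNReal.toReal_ofReal, smul_eq_mul, mul_comm]
    rw [hdens]
    have := (mp_left_pos hl).trans_le ht.1
    positivity
  · rw [Set.indicator_of_notMem ht, hdens, Real.sqrt_eq_zero'.2]
    · simp
    · rw [mpQuad_eq hl0]
      have := mp_left_le_right l
      rw [Set.mem_Icc, not_and_or, not_le, not_le] at ht
      rcases ht with h | h
      · exact mul_nonpos_of_nonpos_of_nonneg (by linarith) (by linarith)
      · exact mul_nonpos_of_nonneg_of_nonpos (by linarith) (by linarith)

lemma integral_zpow_mul_freePoissonDensity {l : ℝ} (hl : 1 < l) (k : ℤ) :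
    ∫ t in (√l - 1) ^ 2..(√l + 1) ^ 2, t ^ k * freePoissonDensity l 1 t =
      mpInt l (k - 1) / (2 * Real.pi) := by
  rw [mpInt, ← intervalIntegral.integral_div]
  refine intervalIntegral.integral_congr fun t ht => ?_
  rw [Set.uIcc_of_le (mp_left_le_right l)] at ht
  have ht0 : t ≠ 0 := ((mp_left_pos hl).trans_le ht.1).ne'
  simp only [freePoissonDensity, mpQuad, zpow_sub_one₀ ht0]
  field_simp

lemma exists_polynomial_near {K : Set ℝ} (hK : IsCompact K) {f : ℝ → ℝ} (hf : ContinuousOn f K)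
    {ε : ℝ} (hε : 0 < ε) : ∃ p : Polynomial ℝ, ∀ x ∈ K, |f x - p.eval x| ≤ ε := by
  have : CompactSpace K := isCompact_iff_compactSpace.1 hK
  let F : C(K, ℝ) := ⟨K.domRestrict f, hf.domRestrict⟩
  have hF : F ∈ (polynomialFunctions K).topologicalClosure := by
    rw [polynomialFunctions.topologicalClosure]
    trivial
  obtain ⟨G, hG, hd⟩ := Metric.mem_closure_iff.1 hF ε hε
  obtain ⟨p, -, rfl⟩ := hG
  refine ⟨p, fun x hx => ?_⟩
  have := (ContinuousMap.dist_apply_le_dist (f := F) (g := _) ⟨x, hx⟩).trans hd.le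
  simpa [F, Real.dist_eq, Set.domRestrict_apply] using this

section CStar

variable {A : Type*} [CStarAlgebra A] {φ : A →ₗ[ℂ] ℂ}

/-- A positive functional is nonnegative on the functional calculus of a nonnegative function. -/
lemma IsState.map_cfc_nonneg (hst : IsState φ) (V : A) {f : ℝ → ℝ}
    (hf : ContinuousOn f (spectrum ℝ V)) (h0 : ∀ t ∈ spectrum ℝ V, 0 ≤ f t) :
    ∃ r : ℝ, 0 ≤ r ∧ φ (cfc f V) = r := by
  obtain ⟨r, hr, h⟩ := hst.2 (cfc (fun t => √(f t)) V)
  refine ⟨r, hr, ?_⟩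
  rw [← h, ← cfc_star, ← cfc_mul _ _ V (by simpa using hf.sqrt) hf.sqrt]
  congr 1
  exact cfc_congr fun t ht => by simp [Real.mul_self_sqrt (h0 t ht)]

lemma IsState.norm_map_cfc_sub_le (hst : IsState φ) {V : A} (hV : IsSelfAdjoint V) {f g : ℝ → ℝ}
    (hf : ContinuousOn f (spectrum ℝ V)) (hg : ContinuousOn g (spectrum ℝ V)) {ε : ℝ}
    (h : ∀ t ∈ spectrum ℝ V, |f t - g t| ≤ ε) : ‖φ (cfc f V) - φ (cfc g V)‖ ≤ ε := by
  have key : ∀ f g : ℝ → ℝ, ContinuousOn f (spectrum ℝ V) → ContinuousOn g (spectrum ℝ V) →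
      (∀ t ∈ spectrum ℝ V, |f t - g t| ≤ ε) →
      ∃ r : ℝ, 0 ≤ r ∧ (ε : ℂ) - (φ (cfc f V) - φ (cfc g V)) = r := by
    intro f g hf hg h
    obtain ⟨r, hr, h⟩ := hst.map_cfc_nonneg V (f := fun t => ε - (f t - g t))
      (continuousOn_const.sub (hf.sub hg)) fun t ht => by linarith [le_of_abs_le (h t ht)]
    refine ⟨r, hr, ?_⟩
    rw [← h, cfc_sub (fun _ => ε) (fun t => f t - g t) V continuousOn_const (hf.sub hg),
      cfc_sub f g V hf hg, cfc_const ε V, map_sub, map_sub]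
    have : algebraMap ℝ A ε = (ε : ℂ) • (1 : A) := by
      rw [Algebra.algebraMap_eq_smul_one, Complex.coe_smul]
    rw [this, map_smul, hst.1, smul_eq_mul, mul_one]
  obtain ⟨r, hr, h1⟩ := key f g hf hg h
  obtain ⟨s, hs, h2⟩ := key g f hg hf fun t ht => by rw [abs_sub_comm]; exact h t ht
  have e : φ (cfc f V) - φ (cfc g V) = ((ε - r : ℝ) : ℂ) := by
    push_cast
    linear_combination -h1
  have e' : r + s = 2 * ε := by
    have : (r : ℂ) + s = 2 * ε := by linear_combination -h1 - h2
    exact_mod_cast this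
  rw [e, Complex.norm_real, Real.norm_eq_abs, abs_le]
  constructor <;> linarith

/-- If the moments of `V` are given by a density on a compact interval, then so are the values of
`φ` on the functional calculus of `V`. -/
theorem IsState.map_cfc_eq_integral (hst : IsState φ) {V : A} (hV : IsSelfAdjoint V) {a b : ℝ}
    {w : ℝ → ℝ} (hw : ContinuousOn w (Set.uIcc a b))
    (hmom : ∀ r : ℕ, φ (V ^ r) = ((∫ t in a..b, t ^ r * w t : ℝ) : ℂ)) {f : ℝ → ℝ}
    (hf : ContinuousOn f (spectrum ℝ V ∪ Set.uIcc a b)) :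
    φ (cfc f V) = ((∫ t in a..b, f t * w t : ℝ) : ℂ) := by
  have hpoly : ∀ p : Polynomial ℝ,
      φ (cfc p.eval V) = ((∫ t in a..b, p.eval t * w t : ℝ) : ℂ) := by
    intro p
    rw [cfc_polynomial p V hV]
    induction p using Polynomial.induction_on' with
    | add p q hp hq =>
      have hi : ∀ p : Polynomial ℝ,
          IntervalIntegrable (fun t => p.eval t * w t) MeasureTheory.volume a b :=
        fun p => (p.continuous.continuousOn.mul hw).intervalIntegrable
      simp only [map_add, hp, hq, Polynomial.eval_add, add_mul]
      rw [intervalIntegral.integral_add (hi p) (hi q)]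
      push_cast
      rfl
    | monomial n c =>
      have : Polynomial.aeval V (Polynomial.monomial n c) = (c : ℂ) • V ^ n := by
        rw [Polynomial.aeval_monomial, ← Algebra.smul_def, Complex.coe_smul]
      rw [this, map_smul, hmom]
      simp only [Polynomial.eval_monomial, mul_assoc]
      rw [intervalIntegral.integral_const_mul]
      push_cast
      rfl
  obtain ⟨M, hM⟩ := isCompact_uIcc.exists_bound_of_continuousOn hw
  have hM0 : 0 ≤ M := (norm_nonneg _).trans (hM a Set.left_mem_uIcc)
  have hbound : ∀ ε : ℝ, 0 < ε →
      ‖φ (cfc f V) - ((∫ t in a..b, f t * w t : ℝ) : ℂ)‖ ≤ ε * (1 + M * |b - a|) := by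
    intro ε hε
    obtain ⟨p, hp⟩ := exists_polynomial_near
      ((ContinuousFunctionalCalculus.isCompact_spectrum V).union isCompact_uIcc) hf hε
    have h1 := hst.norm_map_cfc_sub_le hV (hf.mono Set.subset_union_left)
      p.continuous.continuousOn fun t ht => hp t (Or.inl ht)
    have h2 : ‖φ (cfc p.eval V) - ((∫ t in a..b, f t * w t : ℝ) : ℂ)‖ ≤ ε * M * |b - a| := by
      have hip : IntervalIntegrable (fun t => p.eval t * w t) MeasureTheory.volume a b :=
        (p.continuous.continuousOn.mul hw).intervalIntegrable
      have hif : IntervalIntegrable (fun t => f t * w t) MeasureTheory.volume a b :=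
        ((hf.mono Set.subset_union_right).mul hw).intervalIntegrable
      rw [hpoly, ← Complex.ofReal_sub, Complex.norm_real, ← intervalIntegral.integral_sub hip hif]
      refine intervalIntegral.norm_integral_le_of_norm_le_const fun t ht => ?_
      have ht := Set.uIoc_subset_uIcc ht
      rw [← sub_mul, norm_mul]
      refine mul_le_mul ?_ (hM t ht) (norm_nonneg _) hε.le
      rw [Real.norm_eq_abs, abs_sub_comm]
      exact hp t (Or.inr ht)
    calc _ ≤ _ := norm_sub_le_norm_sub_add_norm_sub _ (φ (cfc p.eval V)) _
      _ ≤ ε + ε * M * |b - a| := add_le_add h1 h2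
      _ = _ := by ring
  refine eq_of_forall_dist_le fun ε hε => ?_
  have hC : 0 < 1 + M * |b - a| := by positivity
  rw [dist_eq_norm]
  simpa [div_mul_cancel₀ _ hC.ne'] using hbound (ε / (1 + M * |b - a|)) (by positivity)

/-- Negative moments of an invertible element with Marchenko–Pastur distribution. -/
lemma IsState.map_inverse_pow (hst : IsState φ) {V : A} (hV : IsSelfAdjoint V) (hU : IsUnit V)
    {l : ℝ} (hl : 1 < l) (hmom : HasMoments (⇑φ) V (freePoissonMeasure l 1)) (k : ℕ) :
    φ (Ring.inverse V ^ k) = ((mpInt l (-k - 1) / (2 * Real.pi) : ℝ) : ℂ) := by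
  have hpos : ∀ t ∈ Set.uIcc ((√l - 1) ^ 2) ((√l + 1) ^ 2), t ≠ 0 := by
    rw [Set.uIcc_of_le (mp_left_le_right l)]
    exact fun t ht => ((mp_left_pos hl).trans_le ht.1).ne'
  have hspec : ∀ t ∈ spectrum ℝ V, t ≠ 0 := by
    rintro t ht rfl
    exact (spectrum.zero_notMem_iff ℝ).2 hU ht
  have hw : ContinuousOn (freePoissonDensity l 1)
      (Set.uIcc ((√l - 1) ^ 2) ((√l + 1) ^ 2)) := by
    refine ContinuousOn.div (by fun_prop) (by fun_prop) fun t ht => ?_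
    have := hpos t ht
    positivity
  have hinv : cfc (fun t : ℝ => t⁻¹) V = Ring.inverse V := by
    obtain ⟨u, rfl⟩ := hU
    rw [cfc_inv_id u, Ring.inverse_unit]
  have hci : ContinuousOn (fun t : ℝ => t⁻¹) (spectrum ℝ V) :=
    continuousOn_id.inv₀ hspec
  rw [← hinv, ← cfc_pow _ k V hci, hst.map_cfc_eq_integral hV hw fun r => by
    rw [hmom r, integral_freePoissonMeasure hl]]
  · rw [← integral_zpow_mul_freePoissonDensity hl]
    simp
  · refine ContinuousOn.pow (continuousOn_id.inv₀ ?_) k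
    rintro t (ht | ht)
    exacts [hspec t ht, hpos t ht]

end CStar

lemma HasMoments.map_pow {A : Type*} [Monoid A] {φ : A → ℂ} {V : A} {l : ℝ} (hl : 1 < l)
    (hmom : HasMoments φ V (freePoissonMeasure l 1)) (k : ℕ) :
    φ (V ^ k) = ((mpInt l (k - 1) / (2 * Real.pi) : ℝ) : ℂ) := by
  rw [hmom, integral_freePoissonMeasure hl, ← integral_zpow_mul_freePoissonDensity hl]
  simp

lemma map_pow_mul_pow {A : Type*} [Monoid A] {φ : A → ℂ} {R : ∀ n, (Fin n → A) → ℂ}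
    (hmc : MomentCumulant φ R) {S T : Set A} (hR : MixedVanish R S T) {a b : A} (ha : a ∈ S)
    (hb : b ∈ T) (m n : ℕ) : φ (a ^ m * b ^ n) = φ (a ^ m) * φ (b ^ n) := by
  have h := map_tprod_mul_tprod hmc hR (x := fun _ : Fin m => a) (y := fun _ : Fin n => b)
    (fun _ => ha) fun _ => hb
  simpa [tprod] using h

lemma inverse_inverse {A : Type*} [MonoidWithZero A] {a : A} (ha : IsUnit a) :
    Ring.inverse (Ring.inverse a) = a := by
  obtain ⟨u, rfl⟩ := ha
  simp

/-- for `X, Y` free and identically free Gamma distributed (i.e. `X⁻¹`, `Y⁻¹`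
free Poisson with rate `l > 1`, jump size 1), `R_3(YX⁻¹, X⁻¹Y, Y) = 4l²/(l−1)⁵`. -/
theorem free_gamma_third_cumulant_Y
    {A : Type*} [NormedRing A] [StarRing A] [CStarRing A] [CompleteSpace A]
    [NormedAlgebra ℂ A] [StarModule ℂ A]
    (φ : A →ₗ[ℂ] ℂ) (R : ∀ n, (Fin n → A) → ℂ)
    (hst : IsState φ) (hfa : Faithful φ) (htr : Tracial φ)
    (hmc : MomentCumulant (⇑φ) R)
    (X Y : A) (hXsa : IsSelfAdjoint X) (hYsa : IsSelfAdjoint Y)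
    (hUX : IsUnit X) (hUY : IsUnit Y)
    (l : ℝ) (hl : 1 < l)
    (hmomX : HasMoments (⇑φ) (Ring.inverse X) (freePoissonMeasure l 1))
    (hmomY : HasMoments (⇑φ) (Ring.inverse Y) (freePoissonMeasure l 1))
    (hid : ∀ r : ℕ, φ (X ^ r) = φ (Y ^ r))
    (hfree : MixedVanish R ({X, Ring.inverse X} : Set A) ({Y, Ring.inverse Y} : Set A)) :
    R 3 ![Y * Ring.inverse X, Ring.inverse X * Y, Y] =
      4 * (l : ℂ) ^ 2 / ((l : ℂ) - 1) ^ 5 := by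
  let _ : CStarAlgebra A := {}
  have hmass : mpInt l (-1) = 2 * Real.pi := by
    have h := HasMoments.map_pow hl hmomX 0
    rw [pow_zero, hst.1] at h
    have h : 1 = mpInt l (-1) / (2 * Real.pi) := by
      simpa using Complex.ofReal_injective (Complex.ofReal_one.trans h)
    field_simp at h
    linarith
  have hπ : 2 * Real.pi ≠ 0 := by positivity
  have hd : l - 1 ≠ 0 := by linarith
  have hdC : (l : ℂ) - 1 ≠ 0 := by exact_mod_cast hd
  have hmomX_eq : ∀ (k : ℕ) (j : ℤ) (c : ℝ), (k : ℤ) - 1 = j → mpInt l j = c * mpInt l (-1) →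
      φ (Ring.inverse X ^ k) = c := by
    rintro k _ c rfl h
    rw [HasMoments.map_pow hl hmomX, h, hmass, mul_div_cancel_right₀ _ hπ]
  have hmomY_eq : ∀ (k : ℕ) (j : ℤ) (c : ℝ), -(k : ℤ) - 1 = j → mpInt l j = c * mpInt l (-1) →
      φ (Y ^ k) = c := by
    rintro k _ c rfl h
    have hY := hst.map_inverse_pow hYsa.ringInverse hUY.ringInverse hl hmomY k
    rwa [inverse_inverse hUY, h, hmass, mul_div_cancel_right₀ _ hπ] at hY
  have hx1 := hmomX_eq 1 0 _ (by norm_num) (mpInt_zero hl)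
  have hx2 := hmomX_eq 2 1 _ (by norm_num) (mpInt_one hl)
  have hy1 := hmomY_eq 1 (-2) (1 / (l - 1)) (by norm_num) (by rw [mpInt_neg_one hl]; field_simp)
  have hy2 := hmomY_eq 2 (-3) _ (by norm_num) (mpInt_neg_three hl)
  have hy3 := hmomY_eq 3 (-4) _ (by norm_num) (mpInt_neg_four hl)
  have hmul := map_pow_mul_pow hmc hfree (a := Ring.inverse X) (b := Y) (by simp) (by simp)
  set U := Ring.inverse X
  have e1 : φ (Y * U * (U * Y) * Y) = φ (U ^ 2) * φ (Y ^ 3) := by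
    rw [← hmul, show Y * U * (U * Y) * Y = Y * (U * U * Y * Y) by noncomm_ring, htr]
    congr 1
    noncomm_ring
  have e2 : φ (Y * U * (U * Y)) = φ (U ^ 2) * φ (Y ^ 2) := by
    rw [← hmul, show Y * U * (U * Y) = Y * (U * U * Y) by noncomm_ring, htr]
    congr 1
    noncomm_ring
  have e3 : φ (Y * U * Y) = φ (U ^ 1) * φ (Y ^ 2) := by
    rw [← hmul, mul_assoc, htr]
    congr 1
    noncomm_ring
  have e4 : φ (U * Y * Y) = φ (U ^ 1) * φ (Y ^ 2) := by
    rw [← hmul]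
    congr 1
    noncomm_ring
  have e5 : φ (U * Y) = φ (U ^ 1) * φ (Y ^ 1) := by
    rw [← hmul, pow_one, pow_one]
  rw [pow_one] at hy1
  rw [pow_one Y] at e5
  rw [cumulant_three hmc, e1, e2, e3, e4, htr Y U, e5, hx1, hx2, hy1, hy2, hy3]
  push_cast
  field_simp
  ring

end FreeProbLukacs
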